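/- arXiv:2405.14068 — 5 statements merged into one kernel-verified Lean document; each statement's English description precedes it below -/
import Mathlib

section
/- Let F be a CDF-valuation, let 0 = m_0 < m_1 < ⋯ < m_k = 1 be a grid, let d > 0 satisfy d ≥ (F(m_i) − F(m_{i−1}))/(m_i − m_{i−1}) for all 1 ≤ i ≤ k, set l_i = m_i − (F(m_i) − F(m_{i−1}))/d and P = ⋃_{i=1}^k [l_i, m_i]. Then for every 1 ≤ i ≤ k, ∫_{[m_{i−1}, m_i]} d·1_P dλ = F(m_i) − F(m_{i−1}); i.e., the constructed piecewise uniform valuation assigns to each grid segment exactly the same value as F. -/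
open MeasureTheory Set

/-- Adjacent comparisons up to `k` make a sequence monotone up to `k`. -/
theorem le_of_forall_lt_succ_of_le {m : ℕ → ℝ} {k : ℕ} (h : ∀ i, i < k → m i < m (i + 1))
    {i j : ℕ} (hij : i ≤ j) (hj : j ≤ k) : m i ≤ m j := by
  induction j, hij using Nat.le_induction with
  | base => exact le_rfl
  | succ n _ ih => exact (ih (by omega)).trans (h n (by omega)).le

/-- The integral over `[a, b]` of a constant times the indicator of a subinterval `[c, b]`. -/
theorem setIntegral_Icc_const_mul_indicator_Icc {a b c : ℝ} (d : ℝ) (hac : a ≤ c) (hcb : c ≤ b) :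
    ∫ x in Icc a b, d * (Icc c b).indicator (fun _ => (1 : ℝ)) x = d * (b - c) := by
  rw [integral_const_mul, setIntegral_indicator measurableSet_Icc,
    inter_eq_self_of_subset_right (Icc_subset_Icc_left hac)]
  simp [hcb]

/-- The piecewise uniform replica valuation assigns to each grid segment
`[m_{i-1}, m_i]` exactly the same value as the original CDF-valuation `F`. -/
theorem pu_replica_agrees_on_segments (F : ℝ → ℝ)
    (hFc : ContinuousOn F (Icc 0 1)) (hFm : MonotoneOn F (Icc 0 1))
    (hF0 : F 0 = 0) (hF1 : F 1 = 1)
    (k : ℕ) (hk : 1 ≤ k) (m : ℕ → ℝ) (hm0 : m 0 = 0) (hmk : m k = 1)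
    (hmono : ∀ i, i < k → m i < m (i + 1))
    (d : ℝ) (hd : 0 < d)
    (hmax : ∀ i, 1 ≤ i → i ≤ k →
      (F (m i) - F (m (i - 1))) / (m i - m (i - 1)) ≤ d)
    (l : ℕ → ℝ)
    (hl : ∀ i, l i = m i - (F (m i) - F (m (i - 1))) / d)
    (P : Set ℝ)
    (hP : P = ⋃ i ∈ Finset.Icc 1 k, Icc (l i) (m i)) :
    ∀ i, 1 ≤ i → i ≤ k →
      ∫ x in Icc (m (i - 1)) (m i), d * P.indicator (fun _ => (1:ℝ)) x
        = F (m i) - F (m (i - 1)) := by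
  intro i hi hik
  have hle : ∀ {a b : ℕ}, a ≤ b → b ≤ k → m a ≤ m b := le_of_forall_lt_succ_of_le hmono
  have hmem : ∀ j, j ≤ k → m j ∈ Icc (0 : ℝ) 1 := fun j hj =>
    ⟨hm0 ▸ hle (Nat.zero_le j) hj, hmk ▸ hle hj le_rfl⟩
  have hl_le : ∀ j, 1 ≤ j → j ≤ k → l j ≤ m j := by
    intro j _ hjk
    have hF := hFm (hmem (j - 1) (by omega)) (hmem j hjk) (hle (by omega) hjk)
    rw [hl]
    linarith [div_nonneg (sub_nonneg.2 hF) hd.le]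
  have hle_l : ∀ j, 1 ≤ j → j ≤ k → m (j - 1) ≤ l j := by
    intro j hj hjk
    have hlt := hmono (j - 1) (by omega)
    rw [Nat.sub_add_cancel hj] at hlt
    have h := (div_le_iff₀ (sub_pos.2 hlt)).1 (hmax j hj hjk)
    have h' := (div_le_iff₀' hd).2 h
    rw [hl]
    linarith
  have hP_iff : ∀ x ∈ Ioc (m (i - 1)) (m i), x ∈ P ↔ x ∈ Icc (l i) (m i) := by
    intro x hx
    simp only [hP, mem_iUnion, Finset.mem_Icc, exists_prop]
    refine ⟨?_, fun h => ⟨i, ⟨hi, hik⟩, h⟩⟩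
    rintro ⟨j, ⟨hj, hjk⟩, hxj⟩
    rcases lt_trichotomy j i with hji | rfl | hij
    · exact absurd (hxj.2.trans (hle (by omega) (by omega))) hx.1.not_ge
    · exact hxj
    · have hmi : m i ≤ m (j - 1) := hle (by omega) (by omega)
      exact ⟨(hl_le i hi hik).trans (hmi.trans ((hle_l j hj hjk).trans hxj.1)), hx.2⟩
  calc ∫ x in Icc (m (i - 1)) (m i), d * P.indicator (fun _ => (1 : ℝ)) x
      = ∫ x in Icc (m (i - 1)) (m i), d * (Icc (l i) (m i)).indicator (fun _ => (1 : ℝ)) x := by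
        rw [integral_Icc_eq_integral_Ioc, integral_Icc_eq_integral_Ioc]
        refine setIntegral_congr_fun measurableSet_Ioc fun x hx => ?_
        by_cases h : x ∈ Icc (l i) (m i)
        · simp only [indicator_of_mem h, indicator_of_mem ((hP_iff x hx).2 h)]
        · simp only [indicator_of_notMem h, indicator_of_notMem (mt (hP_iff x hx).1 h)]
    _ = d * (m i - l i) :=
        setIntegral_Icc_const_mul_indicator_Icc d (hle_l i hi hik) (hl_le i hi hik)
    _ = F (m i) - F (m (i - 1)) := by
        rw [hl]
        field_simp
        ring
end

section
/- Let F be a CDF-valuation, let 0 = m_0 < m_1 < ⋯ < m_k = 1 be a grid, let d > 0 satisfy d ≥ (F(m_i) − F(m_{i−1}))/(m_i − m_{i−1}) for all 1 ≤ i ≤ k, set l_i = m_i − (F(m_i) − F(m_{i−1}))/d and P = ⋃_{i=1}^k [l_i, m_i]. Let Q = ⋃_{s=1}^n [m_{i_s}, m_{i'_s}] be any piece all of whose interval endpoints lie in the grid, with i_1 ≤ i'_1 ≤ i_2 ≤ i'_2 ≤ ⋯ ≤ i_n ≤ i'_n. Then ∫_Q d·1_P dλ = Σ_{s=1}^n (F(m_{i'_s})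 − F(m_{i_s})); i.e., the constructed piecewise uniform valuation agrees with F on every piece with boundary points in the grid. -/
open MeasureTheory Set

/-- On one cell `(u, v]` of the grid, only the suffix `[w, v]` of the piece `P` is visible. -/
lemma intervalIntegral_indicator_of_inter_eq {P : Set ℝ} (hPm : MeasurableSet P) {u v w d : ℝ}
    (huw : u ≤ w) (hwv : w ≤ v) (hP : ∀ x ∈ Ioc u v, (x ∈ P ↔ w ≤ x)) :
    ∫ x in u..v, d * P.indicator (fun _ => (1 : ℝ)) x = d * (v - w) := by
  have hae : (P ∩ Ioc u v : Set ℝ) =ᵐ[volume] Ioc w v := by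
    have hset : Ioc w v ⊆ P ∩ Ioc u v := fun x hx =>
      have hx' : x ∈ Ioc u v := ⟨huw.trans_lt hx.1, hx.2⟩
      ⟨(hP x hx').2 hx.1.le, hx'⟩
    have hset' : P ∩ Ioc u v ⊆ Icc w v := fun x hx => ⟨(hP x hx.2).1 hx.1, hx.2.2⟩
    exact (hset'.eventuallyLE.trans Ioc_ae_eq_Icc.symm.le).antisymm hset.eventuallyLE
  rw [intervalIntegral.integral_of_le (huw.trans hwv), integral_const_mul,
    integral_indicator hPm, Measure.restrict_restrict hPm, setIntegral_congr_set hae]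
  simp [hwv]

/-- Integrals over a finite union of ordered, possibly touching intervals. -/
lemma setIntegral_biUnion_Icc_of_ordered {g : ℝ → ℝ} (S : Finset ℕ) (a b : ℕ → ℝ)
    (hab : ∀ s ∈ S, a s ≤ b s) (hord : ∀ s ∈ S, ∀ t ∈ S, s < t → b s ≤ a t)
    (hg : ∀ s ∈ S, IntegrableOn g (Ioc (a s) (b s))) :
    ∫ x in ⋃ s ∈ S, Icc (a s) (b s), g x = ∑ s ∈ S, ∫ x in (a s)..(b s), g x := by
  have hae : (⋃ s ∈ S, Icc (a s) (b s) : Set ℝ) =ᵐ[volume] ⋃ s ∈ S, Ioc (a s) (b s) :=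
    Filter.EventuallyEq.countable_bUnion S.countable_toSet fun s _ => Ioc_ae_eq_Icc.symm
  rw [setIntegral_congr_set hae, integral_biUnion_finset S (fun _ _ => measurableSet_Ioc) ?_ hg]
  · exact Finset.sum_congr rfl fun s hs => (intervalIntegral.integral_of_le (hab s hs)).symm
  · intro s hs t ht hst
    rw [Function.onFun, Set.disjoint_left]
    intro x hxs hxt
    rcases lt_or_gt_of_ne hst with h | h
    · exact absurd (hxs.2.trans (hord s hs t ht h)) hxt.1.not_ge
    · exact absurd (hxt.2.trans (hord t ht s hs h)) hxs.1.not_ge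

/-- The piecewise uniform replica valuation agrees with the original
CDF-valuation `F` on every piece whose boundary points lie in the grid. -/
theorem pu_replica_agrees_on_grid_pieces (F : ℝ → ℝ)
    (hFc : ContinuousOn F (Icc 0 1)) (hFm : MonotoneOn F (Icc 0 1))
    (hF0 : F 0 = 0) (hF1 : F 1 = 1)
    (k : ℕ) (hk : 1 ≤ k) (m : ℕ → ℝ) (hm0 : m 0 = 0) (hmk : m k = 1)
    (hmono : ∀ i, i < k → m i < m (i + 1))
    (d : ℝ) (hd : 0 < d)
    (hmax : ∀ i, 1 ≤ i → i ≤ k →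
      (F (m i) - F (m (i - 1))) / (m i - m (i - 1)) ≤ d)
    (l : ℕ → ℝ)
    (hl : ∀ i, l i = m i - (F (m i) - F (m (i - 1))) / d)
    (P : Set ℝ)
    (hP : P = ⋃ i ∈ Finset.Icc 1 k, Icc (l i) (m i))
    (n : ℕ) (hn : 1 ≤ n) (idx idx' : ℕ → ℕ)
    (hidx : ∀ s, 1 ≤ s → s ≤ n → idx s ≤ idx' s)
    (hchain : ∀ s, 1 ≤ s → s < n → idx' s ≤ idx (s + 1))
    (htop : idx' n ≤ k)
    (Q : Set ℝ)
    (hQ : Q = ⋃ s ∈ Finset.Icc 1 n, Icc (m (idx s)) (m (idx' s))) :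
    ∫ x in Q, d * P.indicator (fun _ => (1:ℝ)) x
      = ∑ s ∈ Finset.Icc 1 n, (F (m (idx' s)) - F (m (idx s))) := by
  have hmle : ∀ i j, i ≤ j → j ≤ k → m i ≤ m j := by
    intro i j hij
    induction j, hij using Nat.le_induction with
    | base => exact fun _ => le_rfl
    | succ j _ ih => exact fun hj => (ih (by omega)).trans (hmono j (by omega)).le
  have hmem : ∀ i, i ≤ k → m i ∈ Icc (0 : ℝ) 1 := fun i hi =>
    ⟨hm0 ▸ hmle 0 i i.zero_le hi, hmk ▸ hmle i k hi le_rfl⟩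
  have hl_ge : ∀ i, i < k → m i ≤ l (i + 1) := by
    intro i hi
    have hpos : 0 < m (i + 1) - m i := sub_pos.2 (hmono i hi)
    have hdens := hmax (i + 1) (by omega) hi
    rw [Nat.add_sub_cancel, div_le_iff₀ hpos] at hdens
    have hlen : (F (m (i + 1)) - F (m i)) / d ≤ m (i + 1) - m i := by
      rw [div_le_iff₀ hd]
      linarith
    rw [hl, Nat.add_sub_cancel]
    linarith
  have hl_le : ∀ i, i < k → l (i + 1) ≤ m (i + 1) := by
    intro i hi
    have hinc := hFm (hmem i hi.le) (hmem (i + 1) hi) (hmono i hi).le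
    rw [hl, Nat.add_sub_cancel]
    linarith [div_nonneg (sub_nonneg.2 hinc) hd.le]
  have hPm : MeasurableSet P := by
    rw [hP]
    exact Finset.measurableSet_biUnion _ fun _ _ => measurableSet_Icc
  have hint : ∀ u v : ℝ,
      IntegrableOn (fun x => d * P.indicator (fun _ => (1 : ℝ)) x) (Ioc u v) := fun u v =>
    ((integrable_const (1 : ℝ)).indicator hPm).const_mul d
  have hcell : ∀ i, i < k →
      ∫ x in (m i)..(m (i + 1)), d * P.indicator (fun _ => (1 : ℝ)) x
        = F (m (i + 1)) - F (m i) := by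
    intro i hi
    rw [intervalIntegral_indicator_of_inter_eq hPm (hl_ge i hi) (hl_le i hi), hl,
      Nat.add_sub_cancel, sub_sub_cancel, mul_div_cancel₀ _ hd.ne']
    intro x hx
    simp only [hP, mem_iUnion, Finset.mem_Icc, exists_prop]
    constructor
    · rintro ⟨j, ⟨hj1, hjk⟩, hxj⟩
      rcases lt_trichotomy j (i + 1) with h | rfl | h
      · exact absurd (hxj.2.trans (hmle j i (by omega) hi.le)) hx.1.not_ge
      · exact hxj.1
      · obtain ⟨p, rfl⟩ : ∃ p, j = p + 1 := ⟨j - 1, by omega⟩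
        exact (hl_le i hi).trans <| (hmle (i + 1) p (by omega) (by omega)).trans <|
          (hl_ge p (by omega)).trans hxj.1
    · exact fun h => ⟨i + 1, ⟨by omega, hi⟩, h, hx.2⟩
  have hgrid : ∀ a b, a ≤ b → b ≤ k →
      ∫ x in (m a)..(m b), d * P.indicator (fun _ => (1 : ℝ)) x = F (m b) - F (m a) := by
    intro a b hab hbk
    rw [← intervalIntegral.sum_integral_adjacent_intervals_Ico hab fun i hi =>
        (intervalIntegrable_iff_integrableOn_Ioc_of_le
          (hmono i (hi.2.trans_le hbk)).le).2 (hint _ _),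
      Finset.sum_congr rfl fun i hi => hcell i ((Finset.mem_Ico.1 hi).2.trans_le hbk),
      Finset.sum_Ico_sub (fun i => F (m i)) hab]
  have hchain' : ∀ s t, 1 ≤ s → s < t → t ≤ n → idx' s ≤ idx t := by
    intro s t hs hst
    induction t, hst using Nat.le_induction with
    | base => exact fun h => hchain s hs h
    | succ t hst ih =>
      exact fun h => (ih (by omega)).trans <|
        (hidx t (by omega) (by omega)).trans (hchain t (by omega) h)
  have hidx_le : ∀ s, 1 ≤ s → s ≤ n → idx' s ≤ k := by
    intro s hs hsn
    rcases hsn.eq_or_lt with rfl | h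
    · exact htop
    · exact (hchain' s n hs h le_rfl).trans ((hidx n hn le_rfl).trans htop)
  rw [hQ, setIntegral_biUnion_Icc_of_ordered _ _ _ ?_ ?_ fun s _ => hint _ _]
  · refine Finset.sum_congr rfl fun s hs => ?_
    obtain ⟨hs1, hsn⟩ := Finset.mem_Icc.1 hs
    exact hgrid _ _ (hidx s hs1 hsn) (hidx_le s hs1 hsn)
  · intro s hs
    obtain ⟨hs1, hsn⟩ := Finset.mem_Icc.1 hs
    exact hmle _ _ (hidx s hs1 hsn) (hidx_le s hs1 hsn)
  · intro s hs t ht hst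
    obtain ⟨hs1, hsn⟩ := Finset.mem_Icc.1 hs
    obtain ⟨ht1, htn⟩ := Finset.mem_Icc.1 ht
    exact hmle _ _ (hchain' s t hs1 hst htn) ((hidx t ht1 htn).trans (hidx_le t ht1 htn))
end

section
/- Let A be a finite nonempty set (of agents), let (F_a)_{a ∈ A} be a family of CDF-valuations, and let 0 = m_0 < m_1 < ⋯ < m_k = 1 be a grid. Then there exist a real c > 0 and, for each a ∈ A, points l_a(1), …, l_a(k) with m_{i−1} ≤ l_a(i) ≤ m_i for all 1 ≤ i ≤ k, such that, setting P_a = ⋃_{i=1}^k [l_a(i), m_i]: (1) for every a ∈ A and all 0 ≤ i ≤ i' ≤ k, ∫_{[m_i, m_{i'}]} c·1_{P_a} dλ = F_a(m_{i'}) − F_a(m_i) (agreement with F_a on all pieces with boundary points in the grid); and (2) Σ_{i=1}^k (m_i − l_a(i)) = 1/c for every a ∈ A (all agents' piecewise uniform valuations are normalized with a common constant, i.e., the family is easily replaceable on the grid). -/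
open MeasureTheory Set

/-- On one grid cell, the union of right-aligned cell intervals has the measure of the
interval in that cell. -/
theorem volume_real_Icc_inter_iUnion_Icc {k : ℕ} {m l : ℕ → ℝ}
    (hm : ∀ i j, i ≤ j → j ≤ k → m i ≤ m j)
    (hl : ∀ i, 1 ≤ i → i ≤ k → m (i - 1) ≤ l i ∧ l i ≤ m i) {j : ℕ} (hj : j < k) :
    volume.real (Icc (m j) (m (j + 1)) ∩ ⋃ i ∈ Finset.Icc 1 k, Icc (l i) (m i))
      = m (j + 1) - l (j + 1) := by
  obtain ⟨h1, h2⟩ := hl (j + 1) (by omega) (by omega)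
  rw [Nat.add_sub_cancel] at h1
  have hsub : Icc (l (j + 1)) (m (j + 1)) ⊆
      Icc (m j) (m (j + 1)) ∩ ⋃ i ∈ Finset.Icc 1 k, Icc (l i) (m i) := by
    intro x hx
    refine ⟨⟨h1.trans hx.1, hx.2⟩, ?_⟩
    simp only [mem_iUnion]
    exact ⟨j + 1, Finset.mem_Icc.2 ⟨by omega, by omega⟩, hx⟩
  have hsup : Icc (m j) (m (j + 1)) ∩ ⋃ i ∈ Finset.Icc 1 k, Icc (l i) (m i) ⊆
      {m j, m (j + 1)} ∪ Icc (l (j + 1)) (m (j + 1)) := by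
    rintro x ⟨hx, hU⟩
    simp only [mem_iUnion, Finset.mem_Icc] at hU
    obtain ⟨i, ⟨hi1, hik⟩, hxi⟩ := hU
    rcases lt_trichotomy i (j + 1) with h | rfl | h
    · have : m i ≤ m j := hm i j (by omega) (by omega)
      exact Or.inl (Or.inl (le_antisymm (hxi.2.trans this) hx.1))
    · exact Or.inr hxi
    · have : m (j + 1) ≤ m (i - 1) := hm _ _ (by omega) (by omega)
      have hli := (hl i hi1 hik).1
      exact Or.inl (Or.inr (le_antisymm hx.2 ((this.trans hli).trans hxi.1)))
  have hnull : volume ({m j, m (j + 1)} : Set ℝ) = 0 := (Set.toFinite _).measure_zero _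
  have hvol : volume (Icc (m j) (m (j + 1)) ∩ ⋃ i ∈ Finset.Icc 1 k, Icc (l i) (m i))
      = volume (Icc (l (j + 1)) (m (j + 1))) := by
    refine le_antisymm ((measure_mono hsup).trans ?_) (measure_mono hsub)
    exact (measure_union_le _ _).trans (by rw [hnull, zero_add])
  rw [measureReal_def, hvol, Real.volume_Icc, ENNReal.toReal_ofReal (by linarith)]

/-- The integral over consecutive grid cells of a piecewise uniform density whose pieces are
right-aligned in the cells. -/
theorem setIntegral_Icc_piecewise_uniform {k : ℕ} {m l : ℕ → ℝ} (c : ℝ)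
    (hm : ∀ i j, i ≤ j → j ≤ k → m i ≤ m j)
    (hl : ∀ i, 1 ≤ i → i ≤ k → m (i - 1) ≤ l i ∧ l i ≤ m i)
    {i i' : ℕ} (hii' : i ≤ i') (hi' : i' ≤ k) :
    ∫ x in Icc (m i) (m i'),
        c * (⋃ j ∈ Finset.Icc 1 k, Icc (l j) (m j)).indicator (fun _ => (1 : ℝ)) x
      = ∑ j ∈ Finset.Ico i i', c * (m (j + 1) - l (j + 1)) := by
  set U := ⋃ j ∈ Finset.Icc 1 k, Icc (l j) (m j)
  have hUm : MeasurableSet U := Finset.measurableSet_biUnion _ fun _ _ => measurableSet_Icc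
  have hint : ∀ a b : ℝ, IntervalIntegrable
      (fun x => c * U.indicator (fun _ => (1 : ℝ)) x) volume a b := by
    intro a b
    refine IntervalIntegrable.const_mul ?_ c
    rw [intervalIntegrable_iff]
    exact (integrableOn_const (by simp)).indicator hUm
  rw [integral_Icc_eq_integral_Ioc, ← intervalIntegral.integral_of_le (hm i i' hii' hi'),
    ← intervalIntegral.sum_integral_adjacent_intervals_Ico hii' fun j _ => hint _ _]
  refine Finset.sum_congr rfl fun j hj => ?_
  have hj' : j < k := (Finset.mem_Ico.1 hj).2.trans_le hi'
  rw [intervalIntegral.integral_of_le (hm j (j + 1) (by omega) hj'),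
    ← integral_Icc_eq_integral_Ioc, integral_const_mul, setIntegral_indicator hUm,
    setIntegral_const, smul_eq_mul, mul_one, volume_real_Icc_inter_iUnion_Icc hm hl hj']

/-- For any finite family of CDF-valuations and any grid, there exists a
piecewise uniform valuation set that agrees with the family on all pieces with
boundary points in the grid and is easily replaceable on the grid (all agents
share a common normalizing constant `c`). -/
theorem pu_easily_replaceable_exists (A : Type) [Fintype A] [Nonempty A]
    (F : A → ℝ → ℝ)
    (hFc : ∀ a, ContinuousOn (F a) (Icc 0 1))
    (hFm : ∀ a, MonotoneOn (F a) (Icc 0 1))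
    (hF0 : ∀ a, F a 0 = 0) (hF1 : ∀ a, F a 1 = 1)
    (k : ℕ) (hk : 1 ≤ k) (m : ℕ → ℝ) (hm0 : m 0 = 0) (hmk : m k = 1)
    (hmono : ∀ i, i < k → m i < m (i + 1)) :
    ∃ c : ℝ, 0 < c ∧ ∃ l : A → ℕ → ℝ,
      (∀ a, ∀ i, 1 ≤ i → i ≤ k → m (i - 1) ≤ l a i ∧ l a i ≤ m i) ∧
      (∀ a, ∀ i i', i ≤ i' → i' ≤ k →
        ∫ x in Icc (m i) (m i'),
            c * (⋃ j ∈ Finset.Icc 1 k, Icc (l a j) (m j)).indicator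
              (fun _ => (1:ℝ)) x
          = F a (m i') - F a (m i)) ∧
      (∀ a, ∑ i ∈ Finset.Icc 1 k, (m i - l a i) = 1 / c) := by
  have hm : ∀ i j, i ≤ j → j ≤ k → m i ≤ m j := by
    intro i j hij
    induction j, hij using Nat.le_induction with
    | base => exact fun _ => le_rfl
    | succ j _ ih => exact fun hj => (ih (by omega)).trans (hmono j hj).le
  have hmem : ∀ i, i ≤ k → m i ∈ Icc (0 : ℝ) 1 := fun i hi =>
    ⟨hm0 ▸ hm 0 i (by omega) hi, hmk ▸ hm i k hi le_rfl⟩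
  have hF : ∀ a i j, i ≤ j → j ≤ k → F a (m i) ≤ F a (m j) := fun a i j hij hj =>
    hFm a (hmem i (hij.trans hj)) (hmem j hj) (hm i j hij hj)
  obtain ⟨c, hc, hgap⟩ : ∃ c : ℝ, 0 < c ∧ ∀ j < k, 1 ≤ c * (m (j + 1) - m j) := by
    have hpos : ∀ j ∈ Finset.range k, 0 < (m (j + 1) - m j)⁻¹ := fun j hj =>
      inv_pos.2 (sub_pos.2 (hmono j (Finset.mem_range.1 hj)))
    refine ⟨∑ j ∈ Finset.range k, (m (j + 1) - m j)⁻¹,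
      Finset.sum_pos hpos ⟨0, Finset.mem_range.2 hk⟩, fun j hj => ?_⟩
    have hle := Finset.single_le_sum (fun i hi => (hpos i hi).le) (Finset.mem_range.2 hj)
    have hd : 0 < m (j + 1) - m j := sub_pos.2 (hmono j hj)
    calc (1 : ℝ) = (m (j + 1) - m j)⁻¹ * (m (j + 1) - m j) := (inv_mul_cancel₀ hd.ne').symm
      _ ≤ _ := mul_le_mul_of_nonneg_right hle hd.le
  have hl : ∀ a, ∀ i, 1 ≤ i → i ≤ k →
      m (i - 1) ≤ m i - (F a (m i) - F a (m (i - 1))) / c ∧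
        m i - (F a (m i) - F a (m (i - 1))) / c ≤ m i := by
    intro a i hi hik
    obtain ⟨j, rfl⟩ : ∃ j, i = j + 1 := ⟨i - 1, by omega⟩
    rw [Nat.add_sub_cancel]
    have h0 := hF a 0 j (by omega) (by omega)
    have h1 := hF a (j + 1) k hik le_rfl
    rw [hm0, hF0] at h0
    rw [hmk, hF1] at h1
    have hnn : 0 ≤ (F a (m (j + 1)) - F a (m j)) / c :=
      div_nonneg (sub_nonneg.2 (hF a j (j + 1) (by omega) hik)) hc.le
    have hle : (F a (m (j + 1)) - F a (m j)) / c ≤ m (j + 1) - m j := by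
      rw [div_le_iff₀' hc]
      linarith [hgap j hik]
    constructor <;> linarith
  refine ⟨c, hc, fun a i => m i - (F a (m i) - F a (m (i - 1))) / c, hl, ?_, ?_⟩
  · intro a i i' hii' hi'
    rw [setIntegral_Icc_piecewise_uniform c hm (hl a) hii' hi',
      ← Finset.sum_Ico_sub (fun j => F a (m j)) hii']
    refine Finset.sum_congr rfl fun j _ => ?_
    rw [Nat.add_sub_cancel, sub_sub_cancel, mul_div_cancel₀ _ hc.ne']
  · intro a
    simp only [sub_sub_cancel]
    rw [← Finset.sum_div, ← Finset.Ico_add_one_right_eq_Icc, Finset.sum_Ico_eq_sum_range]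
    simp only [Nat.add_sub_cancel, add_comm 1]
    rw [Finset.sum_range_sub (fun j => F a (m j)), hm0, hmk, hF0, hF1, sub_zero]
end

section
/- Let A be a finite nonempty set (of agents), let 0 ≤ y_1 ≤ y_2 ≤ ⋯ ≤ y_n ≤ 1 with y_n = 1, and for each a ∈ A let z_a(1), …, z_a(n) be reals satisfying 0 ≤ z_a(1) ≤ y_1 ≤ z_a(2) ≤ y_2 ≤ ⋯ ≤ z_a(n) ≤ y_n ≤ 1. Suppose the sum s = Σ_{i=1}^n (y_i − z_a(i)) is the same for all a ∈ A and s > 0. Then, setting c = 1/s and P_a = ⋃_{i=1}^n [z_a(i), y_i], each U_a(Q) = ∫_Q c·1_{P_a} dλ is a normalized piecewise uniform valuation (∫_{[0,1]} c·1_{P_a} dλ = 1), the family (U_a) shares the common constant c, and for all 1 ≤ i ≤ i' ≤ n, U_a([y_i, y_{i'}]) = c · Σ_{i < j ≤ i'} (y_j − z_a(j)). (Any satisfying assignment of the ordering-and-normalization constraints ψ(S) yields an easily replaceable piecewise uniform valuation set witnessing the assignment.) -/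
open MeasureTheory Set

section Interleaved

variable {n : ℕ} {y z : ℕ → ℝ}

lemma le_of_interleaved (h : ∀ i < n, y i ≤ z (i + 1) ∧ z (i + 1) ≤ y (i + 1))
    {i j : ℕ} (hij : i ≤ j) (hjn : j ≤ n) : y i ≤ y j := by
  induction j, hij using Nat.le_induction with
  | base => exact le_rfl
  | succ k _ ih =>
    have := h k (by lia)
    linarith [ih (by lia)]

lemma notMem_iUnion_Icc_of_mem_gap
    (h : ∀ i < n, y i ≤ z (i + 1) ∧ z (i + 1) ≤ y (i + 1)) {j : ℕ} (hj : j < n) {x : ℝ}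
    (hx : x ∈ Ioo (y j) (z (j + 1))) : x ∉ ⋃ i ∈ Finset.Icc 1 n, Icc (z i) (y i) := by
  simp only [mem_iUnion, Finset.mem_Icc, not_exists]
  rintro k ⟨hk1, hkn⟩ ⟨hzx, hxy⟩
  rcases Nat.lt_or_ge j k with hjk | hkj
  · obtain ⟨m, rfl⟩ : ∃ m, k = m + 1 := ⟨k - 1, by lia⟩
    rcases (Nat.le_of_lt_succ hjk).eq_or_lt with rfl | hjm
    · exact absurd hx.2 (not_lt.2 hzx)
    · have h1 := le_of_interleaved h (i := j + 1) (j := m) hjm (by lia)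
      linarith [hx.2, (h j hj).2, (h m (by lia)).1]
  · linarith [hx.1, le_of_interleaved h hkj hj.le]

lemma intervalIntegrable_indicator_iUnion_Icc (a b : ℝ) :
    IntervalIntegrable ((⋃ i ∈ Finset.Icc 1 n, Icc (z i) (y i)).indicator fun _ => (1 : ℝ))
      volume a b := by
  have hm : MeasurableSet (⋃ i ∈ Finset.Icc 1 n, Icc (z i) (y i)) :=
    Finset.measurableSet_biUnion _ fun _ _ => measurableSet_Icc
  have hc : IntervalIntegrable (fun _ : ℝ => (1 : ℝ)) volume a b := intervalIntegrable_const
  exact ⟨hc.1.indicator hm, hc.2.indicator hm⟩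

lemma integral_indicator_iUnion_Icc_succ
    (h : ∀ i < n, y i ≤ z (i + 1) ∧ z (i + 1) ≤ y (i + 1)) {j : ℕ} (hj : j < n) :
    ∫ x in y j..y (j + 1),
      (⋃ i ∈ Finset.Icc 1 n, Icc (z i) (y i)).indicator (fun _ => (1 : ℝ)) x
      = y (j + 1) - z (j + 1) := by
  obtain ⟨hyz, hzy⟩ := h j hj
  rw [← intervalIntegral.integral_add_adjacent_intervals
      (intervalIntegrable_indicator_iUnion_Icc (y j) (z (j + 1)))
      (intervalIntegrable_indicator_iUnion_Icc (z (j + 1)) (y (j + 1)))]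
  have hgap : ∫ x in y j..z (j + 1),
      (⋃ i ∈ Finset.Icc 1 n, Icc (z i) (y i)).indicator (fun _ => (1 : ℝ)) x = 0 := by
    rw [intervalIntegral.integral_of_le hyz, integral_Ioc_eq_integral_Ioo]
    exact setIntegral_eq_zero_of_forall_eq_zero fun x hx =>
      indicator_of_notMem (notMem_iUnion_Icc_of_mem_gap h hj hx) _
  have hpiece : ∫ x in z (j + 1)..y (j + 1),
      (⋃ i ∈ Finset.Icc 1 n, Icc (z i) (y i)).indicator (fun _ => (1 : ℝ)) x
      = ∫ _ in z (j + 1)..y (j + 1), (1 : ℝ) := by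
    refine intervalIntegral.integral_congr fun x hx => ?_
    rw [uIcc_of_le hzy] at hx
    exact indicator_of_mem
      (mem_iUnion₂.2 ⟨j + 1, Finset.mem_Icc.2 ⟨by lia, hj⟩, hx⟩) _
  rw [hgap, hpiece]
  simp

lemma setIntegral_indicator_iUnion_Icc
    (h : ∀ i < n, y i ≤ z (i + 1) ∧ z (i + 1) ≤ y (i + 1)) {i j : ℕ} (hij : i ≤ j)
    (hjn : j ≤ n) :
    ∫ x in Icc (y i) (y j),
      (⋃ i ∈ Finset.Icc 1 n, Icc (z i) (y i)).indicator (fun _ => (1 : ℝ)) x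
      = ∑ k ∈ Finset.Ioc i j, (y k - z k) := by
  rw [integral_Icc_eq_integral_Ioc,
    ← intervalIntegral.integral_of_le (le_of_interleaved h hij hjn)]
  induction j, hij using Nat.le_induction with
  | base => simp
  | succ k hik ih =>
    rw [← intervalIntegral.integral_add_adjacent_intervals
        (intervalIntegrable_indicator_iUnion_Icc (y i) (y k))
        (intervalIntegrable_indicator_iUnion_Icc (y k) (y (k + 1))),
      ih (by lia), integral_indicator_iUnion_Icc_succ h (by lia),
      Finset.sum_Ioc_succ_top (by lia)]

end Interleaved

/-- Any satisfying assignment of the ordering-and-normalization constraints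
`ψ(S)` yields an easily replaceable piecewise uniform valuation set witnessing
the assignment: each `U_a` is normalized with common constant `c = 1/s`, and
on grid intervals its value is `c` times the corresponding sum of endpoint
differences. -/
theorem psi_yields_pu_valuations (A : Type) [Fintype A] [Nonempty A]
    (n : ℕ) (hn : 1 ≤ n) (y : ℕ → ℝ)
    (hy0 : 0 ≤ y 1) (hyn : y n = 1)
    (hymono : ∀ i, 1 ≤ i → i < n → y i ≤ y (i + 1))
    (z : A → ℕ → ℝ)
    (hz0 : ∀ a, 0 ≤ z a 1)
    (hzy : ∀ a, ∀ i, 1 ≤ i → i ≤ n → z a i ≤ y i)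
    (hyz : ∀ a, ∀ i, 1 ≤ i → i < n → y i ≤ z a (i + 1))
    (s : ℝ) (hs : 0 < s)
    (hsum : ∀ a, ∑ i ∈ Finset.Icc 1 n, (y i - z a i) = s)
    (c : ℝ) (hc : c = 1 / s)
    (P : A → Set ℝ)
    (hP : ∀ a, P a = ⋃ i ∈ Finset.Icc 1 n, Icc (z a i) (y i)) :
    (∀ a, ∫ x in Icc (0:ℝ) 1, c * (P a).indicator (fun _ => (1:ℝ)) x = 1) ∧
      (∀ a, ∀ i i', 1 ≤ i → i ≤ i' → i' ≤ n →
        ∫ x in Icc (y i) (y i'), c * (P a).indicator (fun _ => (1:ℝ)) x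
          = c * ∑ j ∈ Finset.Ioc i i', (y j - z a j)) := by
  -- Prepend the grid point `0`, so that `[0, 1]` is itself a grid interval.
  set w : ℕ → ℝ := Function.update y 0 0 with hw
  have hw0 : w 0 = 0 := by simp [hw]
  have hwy : ∀ i, 1 ≤ i → w i = y i := fun i hi => by
    rw [hw, Function.update_of_ne (by lia)]
  have hwz : ∀ a, ∀ i < n, w i ≤ z a (i + 1) ∧ z a (i + 1) ≤ w (i + 1) := by
    intro a i hi
    rw [hwy (i + 1) (by lia)]
    refine ⟨?_, hzy a _ (by lia) hi⟩
    rcases Nat.eq_zero_or_pos i with rfl | hpos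
    · rw [hw0]
      exact hz0 a
    · rw [hwy i hpos]
      exact hyz a i hpos hi
  have hPw : ∀ a, P a = ⋃ i ∈ Finset.Icc 1 n, Icc (z a i) (w i) := fun a => by
    rw [hP]
    exact iUnion₂_congr fun i hi => by rw [hwy i (Finset.mem_Icc.1 hi).1]
  have key : ∀ a, ∀ i i', i ≤ i' → i' ≤ n →
      ∫ x in Icc (w i) (w i'), c * (P a).indicator (fun _ => (1 : ℝ)) x
        = c * ∑ j ∈ Finset.Ioc i i', (y j - z a j) := by
    intro a i i' hii' hi'n
    rw [integral_const_mul, hPw, setIntegral_indicator_iUnion_Icc (hwz a) hii' hi'n]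
    congr 1
    refine Finset.sum_congr rfl fun j hj => ?_
    rw [hwy j (by have := Finset.mem_Ioc.1 hj; lia)]
  refine ⟨fun a => ?_, fun a i i' hi hii' hi'n => ?_⟩
  · have hnorm := key a 0 n (Nat.zero_le n) le_rfl
    have hIoc : Finset.Ioc 0 n = Finset.Icc 1 n := by
      ext
      simp [Nat.succ_le_iff]
    rw [hw0, hwy n hn, hyn, hIoc, hsum a, hc, one_div_mul_cancel hs.ne'] at hnorm
    rw [hc]
    exact hnorm
  · rw [← hwy i hi, ← hwy i' (hi.trans hii')]
    exact key a i i' hii' hi'n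
end

section
/- Envy-freeness of the Surplus protocol: let F_1 and F_2 be CDF-valuations, and let m_1, m_2 ∈ [0,1] satisfy F_1(m_1) = 1/2 and F_2(m_2) = 1/2 (each agent marks its half-value point of the cake). If m_2 ≥ m_1, allocate [0, m_1] to agent 1 and [m_2, 1] to agent 2; if m_1 > m_2, allocate [0, m_2] to agent 2 and [m_1, 1] to agent 1. Then in either case the resulting allocation is envy-free: F_1 assigns the piece given to agent 1 a value at least the value F_1 assigns to the piece given to agent 2, and F_2 assigns the piece given to agent 2 a value at least the value F_2 assigns to the piece given to agent 1, where the value of [a,b] under F_i is F_i(b) − F_i(a). -/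
open Set

/-- Envy-freeness of the Surplus protocol: each agent marks its half-value
point of the cake (`F₁ m₁ = 1/2`, `F₂ m₂ = 1/2`); the agent with the leftmost
mark gets everything to the left of its mark, the other gets everything to the
right of its own mark.  In either case the allocation is envy-free. -/
theorem surplus_envy_free (F₁ F₂ : ℝ → ℝ)
    (hF₁c : ContinuousOn F₁ (Icc 0 1)) (hF₁m : MonotoneOn F₁ (Icc 0 1))
    (hF₁0 : F₁ 0 = 0) (hF₁1 : F₁ 1 = 1)
    (hF₂c : ContinuousOn F₂ (Icc 0 1)) (hF₂m : MonotoneOn F₂ (Icc 0 1))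
    (hF₂0 : F₂ 0 = 0) (hF₂1 : F₂ 1 = 1)
    (m₁ m₂ : ℝ) (hm₁0 : 0 ≤ m₁) (hm₁1 : m₁ ≤ 1)
    (hm₂0 : 0 ≤ m₂) (hm₂1 : m₂ ≤ 1)
    (hmark₁ : F₁ m₁ = 1 / 2) (hmark₂ : F₂ m₂ = 1 / 2) :
    (m₂ ≥ m₁ →
      (F₁ m₁ - F₁ 0 ≥ F₁ 1 - F₁ m₂) ∧ (F₂ 1 - F₂ m₂ ≥ F₂ m₁ - F₂ 0)) ∧
    (m₁ > m₂ →
      (F₁ 1 - F₁ m₁ ≥ F₁ m₂ - F₁ 0) ∧ (F₂ m₂ - F₂ 0 ≥ F₂ 1 - F₂ m₁)) := by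
  have h₁ : m₁ ∈ Icc (0 : ℝ) 1 := ⟨hm₁0, hm₁1⟩
  have h₂ : m₂ ∈ Icc (0 : ℝ) 1 := ⟨hm₂0, hm₂1⟩
  refine ⟨fun h => ?_, fun h => ?_⟩
  · have hF₁ := hF₁m h₁ h₂ h
    have hF₂ := hF₂m h₁ h₂ h
    constructor <;> linarith
  · have hF₁ := hF₁m h₂ h₁ h.le
    have hF₂ := hF₂m h₂ h₁ h.le
    constructor <;> linarith
end
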